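/- arXiv:2003.02591 — 6 statements merged into one kernel-verified Lean document; each statement's English description precedes it below -/
import Mathlib

section
/- Let d = 1. Let p ≥ 2, suppose ‖ΔV‖_{L^∞([0,T]×𝕋)} < (2/T²)·(1/p), and suppose there is k_0 > 0 with m_0(x) ≥ k_0 and m_T(x) ≥ k_0 for all x ∈ 𝕋. If (u,m) is a smooth solution of the first-order planning system, then, setting ε := 2 − p T² ‖ΔV‖_{L^∞([0,T]×𝕋)}, for every t ∈ [0,T] one has ∫_𝕋 m(t,x)^{-(p−1)} dx ≤ (2/ε) ( ∫_𝕋 m_0(x)^{-(p−1)} dx + ∫_𝕋 m_T(x)^{-(p−1)} dx ). In particular, max_{t∈[0,T]} ‖m(t,·)^{-1}‖_{L^{p−1}(𝕋)} ≤ C for a constant C depending only on T, V, m_0, m_T, p, and k_0. -/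
open MeasureTheory Real Set

/-- The `L^∞` norm of `ΔV = V_xx` on `[0,T] × 𝕋`. -/
noncomputable def lapVsup1 (T : ℝ) (V : ℝ → ℝ → ℝ) : ℝ :=
  sSup {y : ℝ | ∃ t ∈ Set.Icc (0 : ℝ) T, ∃ x : ℝ, y = |deriv (deriv (V t)) x|}

def LQ.Sm (I : Set ℝ) (f : ℝ → ℝ → ℝ) : Prop :=
  ContDiffOn ℝ (⊤ : ℕ∞) (fun q : ℝ × ℝ => f q.1 q.2) (I ×ˢ (univ : Set ℝ))

noncomputable def LQ.Dx (f : ℝ → ℝ → ℝ) : ℝ → ℝ → ℝ := fun t x => deriv (f t) x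

noncomputable def LQ.Dt (f : ℝ → ℝ → ℝ) : ℝ → ℝ → ℝ := fun t x => deriv (fun s => f s x) t

namespace LQ

lemma Sm.mono {I J : Set ℝ} {f : ℝ → ℝ → ℝ} (h : Sm I f) (hJ : J ⊆ I) : Sm J f :=
  ContDiffOn.mono h (prod_mono hJ subset_rfl)

lemma Sm.contDiff {I : Set ℝ} {f : ℝ → ℝ → ℝ} (h : Sm I f) {t : ℝ} (ht : t ∈ I) :
    ContDiff ℝ (⊤ : ℕ∞) (f t) := by
  rw [← contDiffOn_univ]
  exact ContDiffOn.comp (g := fun q : ℝ × ℝ => f q.1 q.2) (f := fun y : ℝ => (t, y)) h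
    (by fun_prop) (fun y _ => ⟨ht, mem_univ _⟩)

lemma Sm.hasX {I : Set ℝ} {f : ℝ → ℝ → ℝ} (h : Sm I f) {t : ℝ} (ht : t ∈ I) (x : ℝ) :
    HasDerivAt (f t) (Dx f t x) x :=
  (((h.contDiff ht).differentiable (by simp)) x).hasDerivAt

lemma Sm.dx_eq {I : Set ℝ} {f : ℝ → ℝ → ℝ} (h : Sm I f) {t : ℝ} (ht : t ∈ I) (x : ℝ) :
    Dx f t x = fderivWithin ℝ (fun q : ℝ × ℝ => f q.1 q.2) (I ×ˢ univ) (t, x) (0, 1) := by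
  have h1 := (h.differentiableOn (by simp) (t, x) ⟨ht, mem_univ _⟩).hasFDerivWithinAt
  have h2 : HasDerivWithinAt (fun y : ℝ => (t, y)) ((0 : ℝ), (1 : ℝ)) univ x :=
    ((hasDerivAt_const x t).prodMk (hasDerivAt_id x)).hasDerivWithinAt
  have h3 := h1.comp_hasDerivWithinAt x h2 (fun y _ => ⟨ht, mem_univ _⟩)
  rw [hasDerivWithinAt_univ] at h3
  exact h3.deriv

lemma Sm.dx {I : Set ℝ} (hI : UniqueDiffOn ℝ I) {f : ℝ → ℝ → ℝ} (h : Sm I f) : Sm I (Dx f) := by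
  have h1 : ContDiffOn ℝ (⊤ : ℕ∞) (fun q : ℝ × ℝ =>
      fderivWithin ℝ (fun q : ℝ × ℝ => f q.1 q.2) (I ×ˢ univ) q (0, 1)) (I ×ˢ univ) :=
    (ContDiffOn.fderivWithin h (hI.prod uniqueDiffOn_univ) (by simp)).clm_apply contDiffOn_const
  exact h1.congr (fun q hq => h.dx_eq hq.1 q.2)

lemma Sm.cda {I : Set ℝ} (hI : IsOpen I) {f : ℝ → ℝ → ℝ} (h : Sm I f) {t : ℝ} (ht : t ∈ I)
    (x : ℝ) : ContDiffAt ℝ (⊤ : ℕ∞) (fun q : ℝ × ℝ => f q.1 q.2) (t, x) :=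
  ContDiffOn.contDiffAt h ((hI.prod isOpen_univ).mem_nhds ⟨ht, mem_univ _⟩)

lemma Sm.fdx {I : Set ℝ} (hI : IsOpen I) {f : ℝ → ℝ → ℝ} (h : Sm I f) {t : ℝ} (ht : t ∈ I)
    (x : ℝ) : Dx f t x = fderiv ℝ (fun q : ℝ × ℝ => f q.1 q.2) (t, x) (0, 1) := by
  rw [h.dx_eq ht, fderivWithin_of_isOpen (hI.prod isOpen_univ) ⟨ht, mem_univ _⟩]

lemma Sm.fdt' {I : Set ℝ} (hI : IsOpen I) {f : ℝ → ℝ → ℝ} (h : Sm I f) {t : ℝ} (ht : t ∈ I)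
    (x : ℝ) : HasDerivAt (fun s => f s x)
      (fderiv ℝ (fun q : ℝ × ℝ => f q.1 q.2) (t, x) (1, 0)) t := by
  have h1 := ((h.cda hI ht x).differentiableAt (by simp)).hasFDerivAt
  have h2 : HasDerivAt (fun y : ℝ => (y, x)) ((1 : ℝ), (0 : ℝ)) t :=
    ((hasDerivAt_id t).prodMk (hasDerivAt_const t x))
  exact h1.comp_hasDerivAt t h2

lemma Sm.fdt {I : Set ℝ} (hI : IsOpen I) {f : ℝ → ℝ → ℝ} (h : Sm I f) {t : ℝ} (ht : t ∈ I)
    (x : ℝ) : Dt f t x = fderiv ℝ (fun q : ℝ × ℝ => f q.1 q.2) (t, x) (1, 0) :=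
  (h.fdt' hI ht x).deriv

lemma Sm.hasT {I : Set ℝ} (hI : IsOpen I) {f : ℝ → ℝ → ℝ} (h : Sm I f) {t : ℝ} (ht : t ∈ I)
    (x : ℝ) : HasDerivAt (fun s => f s x) (Dt f t x) t := by
  rw [h.fdt hI ht]; exact h.fdt' hI ht x

lemma Sm.dt {I : Set ℝ} (hI : IsOpen I) {f : ℝ → ℝ → ℝ} (h : Sm I f) : Sm I (Dt f) := by
  have h1 : ContDiffOn ℝ (⊤ : ℕ∞) (fun q : ℝ × ℝ =>
      fderiv ℝ (fun q : ℝ × ℝ => f q.1 q.2) q (1, 0)) (I ×ˢ univ) :=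
    (ContDiffOn.fderiv_of_isOpen h (hI.prod isOpen_univ) (by simp)).clm_apply contDiffOn_const
  exact h1.congr (fun q hq => h.fdt hI hq.1 q.2)

lemma dx_congr {I : Set ℝ} {f k : ℝ → ℝ → ℝ} (h : ∀ t ∈ I, ∀ x, f t x = k t x) :
    ∀ t ∈ I, ∀ x, Dx f t x = Dx k t x := fun t ht x => by
  have : f t = k t := funext (h t ht)
  simp only [Dx, this]

lemma dt_congr {I : Set ℝ} (hI : IsOpen I) {f k : ℝ → ℝ → ℝ} (h : ∀ t ∈ I, ∀ x, f t x = k t x) :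
    ∀ t ∈ I, ∀ x, Dt f t x = Dt k t x := fun t ht x => by
  apply Filter.EventuallyEq.deriv_eq
  filter_upwards [hI.mem_nhds ht] with s hs using h s hs x

lemma two_le_inf : (2 : WithTop ℕ∞) ≤ ((⊤ : ℕ∞) : WithTop ℕ∞) :=
  WithTop.coe_le_coe.2 (le_top : (2 : ℕ∞) ≤ ⊤)

lemma Sm.comm {I : Set ℝ} (hI : IsOpen I) {f : ℝ → ℝ → ℝ} (h : Sm I f) {t : ℝ} (ht : t ∈ I)
    (x : ℝ) : Dt (Dx f) t x = Dx (Dt f) t x := by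
  have hs := (h.cda hI ht x).isSymmSndFDerivAt
    (by simp only [minSmoothness_of_isRCLikeNormedField]; exact two_le_inf)
  have hd : DifferentiableAt ℝ (fderiv ℝ (fun q : ℝ × ℝ => f q.1 q.2)) (t, x) :=
    ((h.cda hI ht x).fderiv_right (m := 1) (by rw [one_add_one_eq_two]; exact two_le_inf)).differentiableAt (by simp)
  have key : ∀ a b : ℝ × ℝ, fderiv ℝ (fun q => fderiv ℝ (fun q : ℝ × ℝ => f q.1 q.2) q a) (t, x) b
      = fderiv ℝ (fderiv ℝ (fun q : ℝ × ℝ => f q.1 q.2)) (t, x) b a := by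
    intro a b
    rw [fderiv_clm_apply hd (by fun_prop)]; simp
  have hO : (I ×ˢ univ : Set (ℝ × ℝ)) ∈ nhds (t, x) :=
    (hI.prod isOpen_univ).mem_nhds ⟨ht, mem_univ _⟩
  rw [(h.dx hI.uniqueDiffOn).fdt hI ht, (h.dt hI).fdx hI ht]
  have e1 : (fun q : ℝ × ℝ => Dx f q.1 q.2) =ᶠ[nhds (t, x)]
      (fun q => fderiv ℝ (fun q : ℝ × ℝ => f q.1 q.2) q (0, 1)) := by
    filter_upwards [hO] with q hq using h.fdx hI hq.1 q.2
  have e2 : (fun q : ℝ × ℝ => Dt f q.1 q.2) =ᶠ[nhds (t, x)]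
      (fun q => fderiv ℝ (fun q : ℝ × ℝ => f q.1 q.2) q (1, 0)) := by
    filter_upwards [hO] with q hq using h.fdt hI hq.1 q.2
  rw [e1.fderiv_eq, e2.fderiv_eq, key, key]
  exact hs.eq _ _

def Per (f : ℝ → ℝ → ℝ) : Prop := ∀ t x : ℝ, f t (x + 1) = f t x

lemma Per.dx {f : ℝ → ℝ → ℝ} (h : Per f) : Per (Dx f) := fun t x => by
  have : (fun y => f t (y + 1)) = f t := funext (h t)
  have h2 := deriv_comp_add_const (f t) 1 x
  rw [this] at h2
  exact h2.symm

lemma Per.dt {f : ℝ → ℝ → ℝ} (h : Per f) : Per (Dt f) := fun t x => by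
  simp only [Dt, h _ x]

lemma per_bdd {T : ℝ} {f : ℝ → ℝ → ℝ} (hf : Sm (Icc 0 T) f) (h : Per f) :
    ∃ C, ∀ t ∈ Icc 0 T, ∀ x, |f t x| ≤ C := by
  obtain ⟨C, hC⟩ := (isCompact_Icc.prod isCompact_Icc : IsCompact (Icc 0 T ×ˢ Icc (0:ℝ) 1)).exists_bound_of_continuousOn
    (f := fun q : ℝ × ℝ => f q.1 q.2) (hf.continuousOn.mono (prod_mono subset_rfl (subset_univ _)))
  refine ⟨C, fun t ht x => ?_⟩
  have hp : Function.Periodic (f t) 1 := h t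
  obtain ⟨y, hy, hxy⟩ := hp.exists_mem_Ico₀ one_pos x
  rw [hxy]
  exact hC (t, y) ⟨ht, hy.1, hy.2.le⟩

lemma Sm.cont {I : Set ℝ} {f : ℝ → ℝ → ℝ} (h : Sm I f) {t : ℝ} (ht : t ∈ I) : Continuous (f t) :=
  (h.contDiff ht).continuous

lemma contF {T : ℝ} {f : ℝ → ℝ → ℝ} (hf : Sm (Icc 0 T) f) :
    ContinuousOn (fun t => ∫ x in (0:ℝ)..1, f t x) (Icc 0 T) := by
  rw [continuousOn_iff_continuous_domRestrict]
  have := intervalIntegral.continuous_parametric_intervalIntegral_of_continuous'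
    (X := Icc 0 T) (μ := volume) (f := fun t x => f t x) (by
      have h1 := hf.continuousOn
      exact h1.comp_continuous (f := fun q : Icc 0 T × ℝ => ((q.1 : ℝ), q.2)) (by fun_prop)
        (fun q => ⟨q.1.2, mem_univ _⟩)) 0 1
  exact this

lemma hasF {I : Set ℝ} (hI : IsOpen I) {f : ℝ → ℝ → ℝ} (hf : Sm I f) {t : ℝ} (ht : t ∈ I) :
    HasDerivAt (fun t => ∫ x in (0:ℝ)..1, f t x) (∫ x in (0:ℝ)..1, Dt f t x) t := by
  obtain ⟨r, hr, hrI⟩ := Metric.nhds_basis_closedBall.mem_iff.1 (hI.mem_nhds ht)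
  obtain ⟨C, hC⟩ := ((isCompact_closedBall t r).prod isCompact_Icc :
    IsCompact (Metric.closedBall t r ×ˢ Icc (0:ℝ) 1)).exists_bound_of_continuousOn
    (f := fun q : ℝ × ℝ => Dt f q.1 q.2)
    ((hf.dt hI).continuousOn.mono (prod_mono hrI (subset_univ _)))
  refine (intervalIntegral.hasDerivAt_integral_of_dominated_loc_of_deriv_le
    (F := f) (F' := Dt f) (s := Metric.closedBall t r) (bound := fun _ => C)
    (Metric.closedBall_mem_nhds t hr) ?_ ?_ ?_ ?_ ?_ ?_).2
  · filter_upwards [hI.mem_nhds ht] with s hs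
    exact (hf.cont hs).aestronglyMeasurable
  · exact (hf.cont ht).intervalIntegrable _ _
  · exact ((hf.dt hI).cont ht).aestronglyMeasurable
  · refine Filter.Eventually.of_forall fun x hx s hs => ?_
    rw [uIoc_of_le zero_le_one] at hx
    exact hC (s, x) ⟨hs, hx.1.le, hx.2⟩
  · simp
  · exact Filter.Eventually.of_forall fun x hx s hs => hf.hasT hI (hrI hs) x

lemma intDx {I : Set ℝ} (hI : IsOpen I) {f : ℝ → ℝ → ℝ} (hf : Sm I f) (hp : Per f)
    {t : ℝ} (ht : t ∈ I) : ∫ x in (0:ℝ)..1, Dx f t x = 0 := by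
  rw [intervalIntegral.integral_eq_sub_of_hasDerivAt (f := f t) (fun x _ => hf.hasX ht x)
    (((hf.dx hI.uniqueDiffOn).cont ht).intervalIntegrable _ _)]
  have := hp t 0
  rw [zero_add] at this
  rw [this, sub_self]

lemma pos_lower {T : ℝ} (hT : 0 < T) {u m : ℝ → ℝ → ℝ} (hu : Sm (Icc 0 T) u)
    (hm : Sm (Icc 0 T) m) (hup : Per u) (hmp : Per m) (hnn : ∀ t x, 0 ≤ m t x)
    (hFP : ∀ t ∈ Ioo 0 T, ∀ x, Dt m t x = Dx m t x * Dx u t x + m t x * Dx (Dx u) t x)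
    {k : ℝ} (hk : 0 < k) (h0 : ∀ x, k ≤ m 0 x) (h1 : ∀ x, k ≤ m T x) :
    ∀ t ∈ Icc 0 T, ∀ x, 0 < m t x := by
  have hU : UniqueDiffOn ℝ (Icc 0 T) := uniqueDiffOn_Icc hT
  obtain ⟨C, hC⟩ := per_bdd ((hu.dx hU).dx hU) hup.dx.dx
  have hC0 : 0 ≤ C := (abs_nonneg _).trans (hC 0 ⟨le_rfl, hT.le⟩ 0)
  obtain ⟨η, hη⟩ : ∃ η, η = k / (2 * T) := ⟨_, rfl⟩
  have hη0 : 0 < η := by rw [hη]; positivity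
  have hηT : η * T = k / 2 := by rw [hη]; field_simp
  have hcont : ContinuousOn (fun q : ℝ × ℝ => exp (C * q.1) * m q.1 q.2 + η * q.1)
      (Icc 0 T ×ˢ Icc (0:ℝ) 1) := by
    have := hm.continuousOn.mono (prod_mono (subset_refl (Icc 0 T)) (subset_univ (Icc (0:ℝ) 1)))
    fun_prop
  obtain ⟨⟨a, b⟩, ⟨ha, hb⟩, hmin⟩ := (isCompact_Icc.prod isCompact_Icc :
    IsCompact (Icc 0 T ×ˢ Icc (0:ℝ) 1)).exists_isMinOn
    ⟨(0, 0), ⟨le_rfl, hT.le⟩, le_rfl, zero_le_one⟩ hcont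
  have hmin' : ∀ t ∈ Icc 0 T, ∀ x, exp (C * a) * m a b + η * a ≤ exp (C * t) * m t x + η * t := by
    intro t ht x
    have hp : Function.Periodic (m t) 1 := hmp t
    obtain ⟨y, hy, hxy⟩ := hp.exists_mem_Ico₀ one_pos x
    rw [hxy]
    exact hmin (show ((t, y) : ℝ × ℝ) ∈ _ from ⟨ht, hy.1, hy.2.le⟩)
  have hlow : k ≤ exp (C * a) * m a b + η * a := by
    rcases eq_or_lt_of_le ha.1 with h | h
    · dsimp only at h; subst h; simpa using h0 b
    rcases eq_or_lt_of_le ha.2 with h' | h'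
    · dsimp only at h'; subst h'
      have e1 : 1 ≤ exp (C * a) := one_le_exp (by positivity)
      nlinarith [h1 b, mul_pos hη0 hT]
    exfalso
    dsimp only at h h'
    have haI : a ∈ Ioo 0 T := ⟨h, h'⟩
    have hx0 : Dx m a b = 0 := by
      apply IsLocalMin.deriv_eq_zero
      refine Filter.Eventually.of_forall fun y => ?_
      have := hmin' a ha y
      have e := exp_pos (C * a)
      exact le_of_mul_le_mul_left (by linarith) e
    have hmt := (hm.mono Ioo_subset_Icc_self).hasT isOpen_Ioo haI b
    have hd : HasDerivAt (fun t => exp (C * t) * m t b + η * t)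
        (exp (C * a) * (C * 1) * m a b + exp (C * a) * Dt m a b + η * 1) a :=
      (((((hasDerivAt_id a).const_mul C).exp).mul hmt).add ((hasDerivAt_id a).const_mul η))
    have hloc : IsLocalMin (fun t => exp (C * t) * m t b + η * t) a := by
      filter_upwards [isOpen_Ioo.mem_nhds haI] with t ht
      exact hmin' t ⟨ht.1.le, ht.2.le⟩ b
    have hz := hloc.hasDerivAt_eq_zero hd
    rw [hFP a haI b, hx0] at hz
    have h3 := (abs_le.1 (hC a ha b)).1
    have h4 : 0 ≤ exp (C * a) * (m a b * (C + Dx (Dx u) a b)) :=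
      mul_nonneg (exp_pos _).le (mul_nonneg (hnn _ _) (by linarith))
    nlinarith
  intro t ht x
  have := hlow.trans (hmin' t ht x)
  have h5 : η * t ≤ η * T := mul_le_mul_of_nonneg_left ht.2 hη0.le
  have h6 : 0 < exp (C * t) * m t x := by linarith
  exact pos_of_mul_pos_right h6 (exp_pos _).le

lemma convex_bound {T : ℝ} (hT : 0 < T) {F F1 F2 : ℝ → ℝ} (hF : ContinuousOn F (Icc 0 T))
    (hnn : ∀ t ∈ Icc 0 T, 0 ≤ F t)
    (h1 : ∀ t ∈ Ioo 0 T, HasDerivAt F (F1 t) t) (h2 : ∀ t ∈ Ioo 0 T, HasDerivAt F1 (F2 t) t)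
    {K : ℝ} (hK : 0 ≤ K) (hKT : K * T ^ 2 < 2) (h3 : ∀ t ∈ Ioo 0 T, -(K * F t) ≤ F2 t) :
    ∀ t ∈ Icc 0 T, F t ≤ 2 / (2 - K * T ^ 2) * (F 0 + F T) := by
  obtain ⟨s, hs, hmax⟩ := isCompact_Icc.exists_isMaxOn (nonempty_Icc.2 hT.le) hF
  have hM : ∀ t ∈ Icc 0 T, F t ≤ F s := fun t ht => hmax ht
  have h00 := hnn 0 ⟨le_rfl, hT.le⟩
  have hTT := hnn T ⟨hT.le, le_rfl⟩
  have hss := hnn s hs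
  have hconv : ConvexOn ℝ (Icc 0 T) (fun t => F t + K * F s / 2 * (t * (t - T))) := by
    refine convexOn_of_hasDerivWithinAt2_nonneg (convex_Icc 0 T)
      (f' := fun t => F1 t + K * F s / 2 * (1 * (t - T) + t * 1))
      (f'' := fun t => F2 t + K * F s / 2 * (1 * 1 + 1)) ?_ ?_ ?_ ?_
    · fun_prop
    · intro t ht
      rw [interior_Icc] at ht ⊢
      exact ((h1 t ht).add (((hasDerivAt_id t).mul
        ((hasDerivAt_id t).sub_const T)).const_mul _)).hasDerivWithinAt
    · intro t ht
      rw [interior_Icc] at ht ⊢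
      exact ((h2 t ht).add (((((hasDerivAt_id t).sub_const T).const_mul 1).add
        ((hasDerivAt_id t).mul_const 1)).const_mul _)).hasDerivWithinAt.congr_deriv (by ring)
    · intro t ht
      rw [interior_Icc] at ht
      have a := h3 t ht
      have b := mul_le_mul_of_nonneg_left (hM t ⟨ht.1.le, ht.2.le⟩) hK
      linarith
  have hle := hconv.le_max_of_mem_Icc (x := 0) (y := T) (z := s) ⟨le_rfl, hT.le⟩
    ⟨hT.le, le_rfl⟩ hs
  have hsum : F s + K * F s / 2 * (s * (s - T)) ≤ F 0 + F T := by
    refine hle.trans ?_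
    simp only [sub_self, mul_zero, zero_mul, add_zero]
    exact max_le (by linarith) (by linarith)
  have hsT : s * (T - s) ≤ T ^ 2 := by nlinarith [hs.1, hs.2]
  have hKF : 0 ≤ K * F s / 2 := by positivity
  have h7 := mul_le_mul_of_nonneg_left hsT hKF
  intro t ht
  refine (hM t ht).trans ?_
  rw [div_mul_eq_mul_div, le_div_iff₀ (by linarith)]
  nlinarith

lemma main_ineq {T : ℝ} {V u m : ℝ → ℝ → ℝ} {g : ℝ → ℝ} (hg : ContDiffOn ℝ (⊤ : ℕ∞) g (Ici 0))
    (hgm : MonotoneOn g (Ici 0)) (hV : Sm (Ioo 0 T) V) (hu : Sm (Ioo 0 T) u) (hm : Sm (Ioo 0 T) m)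
    (hup : Per u) (hmp : Per m) (hpos : ∀ t ∈ Ioo 0 T, ∀ x, 0 < m t x)
    (hFP : ∀ t ∈ Ioo 0 T, ∀ x, Dt m t x = Dx m t x * Dx u t x + m t x * Dx (Dx u) t x)
    (hHJ : ∀ t ∈ Ioo 0 T, ∀ x, Dt u t x = (Dx u t x) ^ 2 / 2 + V t x - g (m t x))
    {p L : ℝ} (hp : 2 ≤ p) (hL : ∀ t ∈ Ioo 0 T, ∀ x, |Dx (Dx V) t x| ≤ L)
    {w : ℝ → ℝ → ℝ} (hw : w = fun t x => m t x ^ (-(p - 1))) (hws : Sm (Ioo 0 T) w) :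
    ∀ t ∈ Ioo 0 T, -(p * L * ∫ x in (0:ℝ)..1, w t x) ≤ ∫ x in (0:ℝ)..1, Dt (Dt w) t x := by
  have hO : IsOpen (Ioo 0 T) := isOpen_Ioo
  have hU := hO.uniqueDiffOn (𝕜 := ℝ)
  have hwp : Per w := fun t x => by simp only [hw, hmp t x]
  have hgat : ∀ y : ℝ, 0 < y → ContDiffAt ℝ (⊤ : ℕ∞) g y := fun y hy =>
    hg.contDiffAt (Ici_mem_nhds hy)
  obtain ⟨G, hGdef⟩ : ∃ G : ℝ → ℝ → ℝ, G = fun t x => g (m t x) := ⟨_, rfl⟩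
  have hG : Sm (Ioo 0 T) G := by
    rw [hGdef]
    intro q hq
    exact ContDiffAt.comp_contDiffWithinAt (g := g) (f := fun q : ℝ × ℝ => m q.1 q.2) q
      (hgat _ (hpos q.1 hq.1 q.2)) (hm q hq)
  have hGp : Per G := fun t x => by simp only [hGdef, hmp t x]
  have hGx : ∀ t ∈ Ioo 0 T, ∀ x, Dx G t x = deriv g (m t x) * Dx m t x := by
    intro t ht x
    rw [hGdef]
    exact ((((hgat _ (hpos t ht x)).differentiableAt (by simp)).hasDerivAt).comp x
      (hm.hasX ht x)).deriv
  have hg' : ∀ y : ℝ, 0 < y → 0 ≤ deriv g y := fun y hy => by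
    rw [← derivWithin_of_mem_nhds (Ici_mem_nhds hy)]
    exact hgm.derivWithin_nonneg
  obtain ⟨v, hv⟩ : ∃ v, v = Dx u := ⟨_, rfl⟩
  have hvs : Sm (Ioo 0 T) v := hv ▸ hu.dx hU
  have hvp : Per v := hv ▸ hup.dx
  rw [← hv] at hFP hHJ
  have hvx := hvs.dx hU
  -- x and t derivatives of w
  have hwx : ∀ t ∈ Ioo 0 T, ∀ x, Dx w t x = Dx m t x * (-(p - 1)) * m t x ^ (-p) := by
    intro t ht x
    have := ((hm.hasX ht x).rpow_const (p := -(p - 1)) (Or.inl (hpos t ht x).ne')).deriv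
    rw [show -(p - 1) - 1 = -p by ring] at this
    rw [hw]; exact this
  have hwt : ∀ t ∈ Ioo 0 T, ∀ x, Dt w t x = Dt m t x * (-(p - 1)) * m t x ^ (-p) := by
    intro t ht x
    have := ((hm.hasT hO ht x).rpow_const (p := -(p - 1)) (Or.inl (hpos t ht x).ne')).deriv
    rw [show -(p - 1) - 1 = -p by ring] at this
    rw [hw]; exact this
  have hwm : ∀ t ∈ Ioo 0 T, ∀ x, w t x = m t x * m t x ^ (-p) := by
    intro t ht x
    simp only [hw]
    rw [show -(p - 1) = 1 + -p by ring, rpow_add (hpos t ht x), rpow_one]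
  have hwt' : ∀ t ∈ Ioo 0 T, ∀ x, Dt w t x = Dx w t x * v t x - (p - 1) * (w t x * Dx v t x) := by
    intro t ht x
    rw [hwt t ht x, hwx t ht x, hwm t ht x, hFP t ht x]; ring
  -- equation for v
  have hvt : ∀ t ∈ Ioo 0 T, ∀ x, Dt v t x = v t x * Dx v t x + Dx V t x - Dx G t x := by
    intro t ht x
    rw [hv, hu.comm hO ht x, ← hv]
    rw [dx_congr (k := fun t x => v t x ^ 2 / 2 + V t x - G t x)
      (fun t ht x => by rw [hHJ t ht x, hGdef]) t ht x]
    have := ((((hvs.hasX ht x).pow 2).div_const 2).add (hV.hasX ht x)).sub (hG.hasX ht x)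
    refine this.deriv.trans ?_
    simp; ring
  have hvxt : ∀ t ∈ Ioo 0 T, ∀ x, Dt (Dx v) t x = Dx v t x * Dx v t x + v t x * Dx (Dx v) t x
      + Dx (Dx V) t x - Dx (Dx G) t x := by
    intro t ht x
    rw [hvs.comm hO ht x, dx_congr hvt t ht x]
    exact ((((hvs.hasX ht x).mul (hvx.hasX ht x))).add ((hV.dx hU).hasX ht x)).sub
      ((hG.dx hU).hasX ht x) |>.deriv
  obtain ⟨W, hW⟩ : ∃ W : ℝ → ℝ → ℝ, W = fun t x => w t x * v t x := ⟨_, rfl⟩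
  have hWs : Sm (Ioo 0 T) W := by rw [hW]; exact ContDiffOn.mul hws hvs
  have hWp : Per W := fun t x => by simp only [hW, hwp t x, hvp t x]
  have hWx : ∀ t ∈ Ioo 0 T, ∀ x, Dx W t x = Dx w t x * v t x + w t x * Dx v t x := by
    intro t ht x
    rw [hW]; exact ((hws.hasX ht x).mul (hvs.hasX ht x)).deriv
  have hwtt : ∀ t ∈ Ioo 0 T, ∀ x, Dt (Dt w) t x = Dx (Dt W) t x -
      p * (Dt w t x * Dx v t x + w t x * Dt (Dx v) t x) := by
    intro t ht x
    rw [dt_congr hO (k := fun t x => Dx W t x - p * (w t x * Dx v t x))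
      (fun t ht x => by rw [hwt' t ht x, hWx t ht x]; ring) t ht x, ← hWs.comm hO ht x]
    exact (((hWs.dx hU).hasT hO ht x).sub
      (((hws.hasT hO ht x).mul (hvx.hasT hO ht x)).const_mul p)).deriv
  obtain ⟨Z, hZ⟩ : ∃ Z : ℝ → ℝ → ℝ, Z = fun t x => Dt W t x - p * (w t x * (v t x * Dx v t x))
      + p * (w t x * Dx G t x) := ⟨_, rfl⟩
  have hZs : Sm (Ioo 0 T) Z := by
    rw [hZ]
    exact ((hWs.dt hO).sub (contDiffOn_const.mul (ContDiffOn.mul hws (ContDiffOn.mul hvs hvx)))).add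
      (contDiffOn_const.mul (ContDiffOn.mul hws (hG.dx hU)))
  have hZp : Per Z := fun t x => by
    simp only [hZ, hwp t x, hvp t x, hWp.dt t x, hvp.dx t x, hGp.dx t x]
  have hZx : ∀ t ∈ Ioo 0 T, ∀ x, Dx Z t x = Dx (Dt W) t x
      - p * (Dx w t x * (v t x * Dx v t x)
        + w t x * (Dx v t x * Dx v t x + v t x * Dx (Dx v) t x))
      + p * (Dx w t x * Dx G t x + w t x * Dx (Dx G) t x) := by
    intro t ht x
    rw [hZ]
    exact ((((hWs.dt hO).hasX ht x).sub (((hws.hasX ht x).mul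
      ((hvs.hasX ht x).mul (hvx.hasX ht x))).const_mul p)).add
      (((hws.hasX ht x).mul ((hG.dx hU).hasX ht x)).const_mul p)).deriv
  intro t ht
  have hpt : ∀ x, Dx Z t x - p * L * w t x ≤ Dt (Dt w) t x := by
    intro x
    have hmx := hpos t ht x
    have hwpos : 0 < w t x := by rw [hw]; exact rpow_pos_of_pos hmx _
    have e1 : 0 ≤ p * (p - 1) * (w t x * (Dx v t x) ^ 2) := by
      have : 0 ≤ p * (p - 1) := mul_nonneg (by linarith) (by linarith)
      positivity
    have e2 : 0 ≤ -(p * (Dx w t x * Dx G t x)) := by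
      rw [hwx t ht x, hGx t ht x]
      have a1 : 0 ≤ p * (p - 1) := mul_nonneg (by linarith) (by linarith)
      have a2 := hg' _ hmx
      have a3 := (rpow_pos_of_pos hmx (-p)).le
      have : 0 ≤ p * (p - 1) * (deriv g (m t x) * m t x ^ (-p) * (Dx m t x) ^ 2) := by positivity
      linarith
    have e3 : p * (w t x * Dx (Dx V) t x) ≤ p * (w t x * L) := by
      have := (abs_le.1 (hL t ht x)).2
      have hp0 : 0 ≤ p := by linarith
      gcongr
    rw [hwtt t ht x, hvxt t ht x, hwt' t ht x, hZx t ht x]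
    linarith
  have hi1 : IntervalIntegrable (Dx Z t) volume 0 1 :=
    ((hZs.dx hU).cont ht).intervalIntegrable _ _
  have hi2 : IntervalIntegrable (fun x => p * L * w t x) volume 0 1 :=
    ((hws.cont ht).const_mul _).intervalIntegrable _ _
  have := intervalIntegral.integral_mono_on zero_le_one (hi1.sub hi2)
    ((((hws.dt hO).dt hO).cont ht).intervalIntegrable 0 1) (fun x _ => hpt x)
  rw [intervalIntegral.integral_sub hi1 hi2, intDx hO hZs hZp ht,
    intervalIntegral.integral_const_mul, zero_sub] at this
  exact this

end LQ

theorem lq_bound_inverse_density_1d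
    (T : ℝ) (hT : 0 < T)
    (V : ℝ → ℝ → ℝ)
    (hV : ContDiffOn ℝ (⊤ : ℕ∞) (fun q : ℝ × ℝ => V q.1 q.2)
      (Set.Icc (0 : ℝ) T ×ˢ (Set.univ : Set ℝ)))
    (hVper : ∀ t x : ℝ, V t (x + 1) = V t x)
    (g : ℝ → ℝ) (hg : ContDiffOn ℝ (⊤ : ℕ∞) g (Set.Ici 0)) (hgmono : MonotoneOn g (Set.Ici 0))
    (m₀ mT : ℝ → ℝ)
    (hm₀sm : ContDiff ℝ (⊤ : ℕ∞) m₀) (hmTsm : ContDiff ℝ (⊤ : ℕ∞) mT)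
    (hm₀per : ∀ x : ℝ, m₀ (x + 1) = m₀ x) (hmTper : ∀ x : ℝ, mT (x + 1) = mT x)
    (hm₀nn : ∀ x, 0 ≤ m₀ x) (hmTnn : ∀ x, 0 ≤ mT x)
    (hm₀pr : ∫ x in Set.Icc (0 : ℝ) 1, m₀ x = 1)
    (hmTpr : ∫ x in Set.Icc (0 : ℝ) 1, mT x = 1)
    (u m : ℝ → ℝ → ℝ)
    (hu : ContDiffOn ℝ (⊤ : ℕ∞) (fun q : ℝ × ℝ => u q.1 q.2)
      (Set.Icc (0 : ℝ) T ×ˢ (Set.univ : Set ℝ)))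
    (hm : ContDiffOn ℝ (⊤ : ℕ∞) (fun q : ℝ × ℝ => m q.1 q.2)
      (Set.Icc (0 : ℝ) T ×ˢ (Set.univ : Set ℝ)))
    (huper : ∀ t x : ℝ, u t (x + 1) = u t x)
    (hmper : ∀ t x : ℝ, m t (x + 1) = m t x)
    (hmnn : ∀ t x, 0 ≤ m t x)
    (hHJ : ∀ t ∈ Set.Ioo (0 : ℝ) T, ∀ x : ℝ,
      -(deriv (fun s => u s x) t) + (deriv (u t) x) ^ 2 / 2 + V t x = g (m t x))
    (hFP : ∀ t ∈ Set.Ioo (0 : ℝ) T, ∀ x : ℝ,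
      deriv (fun s => m s x) t = deriv (fun y => m t y * deriv (u t) y) x)
    (hini : ∀ x, m 0 x = m₀ x) (hter : ∀ x, m T x = mT x)
    (k₀ : ℝ) (hk₀ : 0 < k₀)
    (hm₀lb : ∀ x, k₀ ≤ m₀ x) (hmTlb : ∀ x, k₀ ≤ mT x)
    (p : ℝ) (hp : 2 ≤ p)
    (hVsmall : lapVsup1 T V < 2 / T ^ 2 * (1 / p)) :
    ∀ t ∈ Set.Icc (0 : ℝ) T,
      ∫ x in Set.Icc (0 : ℝ) 1, m t x ^ (-(p - 1)) ≤
        2 / (2 - p * T ^ 2 * lapVsup1 T V) *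
          ((∫ x in Set.Icc (0 : ℝ) 1, m₀ x ^ (-(p - 1))) +
            ∫ x in Set.Icc (0 : ℝ) 1, mT x ^ (-(p - 1))) := by
  have hV' : LQ.Sm (Icc 0 T) V := hV
  have hu' : LQ.Sm (Icc 0 T) u := hu
  have hm' : LQ.Sm (Icc 0 T) m := hm
  have hsub : Ioo 0 T ⊆ Icc 0 T := Ioo_subset_Icc_self
  have hU : UniqueDiffOn ℝ (Icc 0 T) := uniqueDiffOn_Icc hT
  have hVp : LQ.Per V := hVper
  have hup : LQ.Per u := huper
  have hmp : LQ.Per m := hmper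
  obtain ⟨C, hC⟩ := LQ.per_bdd ((hV'.dx hU).dx hU) hVp.dx.dx
  have hL : ∀ t ∈ Icc 0 T, ∀ x, |LQ.Dx (LQ.Dx V) t x| ≤ lapVsup1 T V := by
    intro t ht x
    refine le_csSup ⟨C, ?_⟩ ⟨t, ht, x, rfl⟩
    rintro y ⟨s, hs, z, rfl⟩
    exact hC s hs z
  have hL0 : 0 ≤ lapVsup1 T V := (abs_nonneg _).trans (hL 0 ⟨le_rfl, hT.le⟩ 0)
  have hFP' : ∀ t ∈ Ioo 0 T, ∀ x, LQ.Dt m t x =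
      LQ.Dx m t x * LQ.Dx u t x + m t x * LQ.Dx (LQ.Dx u) t x := by
    intro t ht x
    refine (hFP t ht x).trans ?_
    exact ((hm'.hasX (hsub ht) x).mul ((hu'.dx hU).hasX (hsub ht) x)).deriv
  have hHJ' : ∀ t ∈ Ioo 0 T, ∀ x, LQ.Dt u t x =
      (LQ.Dx u t x) ^ 2 / 2 + V t x - g (m t x) := by
    intro t ht x
    have := hHJ t ht x
    simp only [LQ.Dt, LQ.Dx]
    linarith
  have hpos := LQ.pos_lower hT hu' hm' hup hmp hmnn hFP' hk₀
    (fun x => by rw [hini]; exact hm₀lb x) (fun x => by rw [hter]; exact hmTlb x)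
  have hws : LQ.Sm (Icc 0 T) (fun t x => m t x ^ (-(p - 1))) := by
    intro q hq
    exact (hm q hq).rpow_const_of_ne (hpos q.1 hq.1 q.2).ne'
  have hO : IsOpen (Ioo 0 T) := isOpen_Ioo
  have hws' := hws.mono hsub
  have hineq := LQ.main_ineq hg hgmono (hV'.mono hsub) (hu'.mono hsub) (hm'.mono hsub) hup hmp
    (fun t ht => hpos t (hsub ht)) hFP' hHJ' hp (fun t ht => hL t (hsub ht)) rfl hws'
  have hp0 : 0 < p := by linarith
  have hKT : p * lapVsup1 T V * T ^ 2 < 2 := by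
    have h1 : 2 / T ^ 2 * (1 / p) = 2 / (p * T ^ 2) := by field_simp
    rw [h1, lt_div_iff₀ (by positivity)] at hVsmall
    linarith
  have hmain := LQ.convex_bound hT (LQ.contF hws)
    (fun t ht => intervalIntegral.integral_nonneg zero_le_one
      (fun x _ => rpow_nonneg (hmnn t x) _))
    (fun t ht => LQ.hasF hO hws' ht) (fun t ht => LQ.hasF hO (hws'.dt hO) ht)
    (mul_nonneg hp0.le hL0) hKT hineq
  intro t ht
  have hfin := hmain t ht
  simp only [hini, hter] at hfin
  simp only [integral_Icc_eq_integral_Ioc, ← intervalIntegral.integral_of_le zero_le_one]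
  rw [show p * T ^ 2 * lapVsup1 T V = p * lapVsup1 T V * T ^ 2 by ring]
  exact hfin
end

section
/- Let T > 0, 0 < ε ≤ 2, a, b ≥ 0, and 0 ≤ c ≤ (2−ε)/T². Let f ∈ C²([0,T]) be non-negative with f''(t) + c f(t) ≥ 0 for all t ∈ [0,T], f(0) = a, and f(T) = b. Then 0 ≤ f(t) ≤ 2(a+b)/ε for all t ∈ [0,T]. -/
open Set

theorem uniform_bound_convexity_type
    (T : ℝ) (hT : 0 < T) (ε : ℝ) (hε : 0 < ε) (hε2 : ε ≤ 2)
    (a b : ℝ) (ha : 0 ≤ a) (hb : 0 ≤ b)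
    (c : ℝ) (hc0 : 0 ≤ c) (hc : c ≤ (2 - ε) / T ^ 2)
    (f f' f'' : ℝ → ℝ)
    (hf' : ∀ t ∈ Set.Icc (0 : ℝ) T, HasDerivWithinAt f (f' t) (Set.Icc (0 : ℝ) T) t)
    (hf'' : ∀ t ∈ Set.Icc (0 : ℝ) T, HasDerivWithinAt f' (f'' t) (Set.Icc (0 : ℝ) T) t)
    (hf''cont : ContinuousOn f'' (Set.Icc (0 : ℝ) T))
    (hfnn : ∀ t ∈ Set.Icc (0 : ℝ) T, 0 ≤ f t)
    (hode : ∀ t ∈ Set.Icc (0 : ℝ) T, 0 ≤ f'' t + c * f t)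
    (hf0 : f 0 = a) (hfT : f T = b) :
    ∀ t ∈ Set.Icc (0 : ℝ) T, 0 ≤ f t ∧ f t ≤ 2 * (a + b) / ε := by
  intro t ht
  refine ⟨hfnn t ht, ?_⟩
  have hfc : ContinuousOn f (Set.Icc (0 : ℝ) T) := fun x hx => (hf' x hx).continuousWithinAt
  obtain ⟨s, hs, hmax⟩ := isCompact_Icc.exists_isMaxOn ⟨t, ht⟩ hfc
  have hM : ∀ x ∈ Set.Icc (0 : ℝ) T, f x ≤ f s := fun x hx => hmax hx
  have hM0 : 0 ≤ f s := hfnn s hs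
  have hconv : ConvexOn ℝ (Set.Icc (0 : ℝ) T) (fun x => f x + c * f s / 2 * x ^ 2) := by
    refine convexOn_of_hasDerivWithinAt2_nonneg (f' := fun x => f' x + c * f s * x)
      (f'' := fun x => f'' x + c * f s) (convex_Icc _ _) ?_ ?_ ?_ ?_
    · exact hfc.add (by fun_prop)
    · intro x hx
      have h1 := (hf' x (interior_subset hx)).mono interior_subset
      have h2 := (((hasDerivAt_pow 2 x).const_mul (c * f s / 2)).hasDerivWithinAt
        (s := interior (Set.Icc (0 : ℝ) T)))
      refine (h1.add h2).congr_deriv ?_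
      push_cast
      ring
    · intro x hx
      have h1 := (hf'' x (interior_subset hx)).mono interior_subset
      have h2 := (((hasDerivAt_id x).const_mul (c * f s)).hasDerivWithinAt
        (s := interior (Set.Icc (0 : ℝ) T)))
      refine (h1.add h2).congr_deriv ?_
      ring
    · intro x hx
      have hx' := interior_subset hx
      have := hode x hx'
      have := mul_le_mul_of_nonneg_left (hM x hx') hc0
      show 0 ≤ f'' x + c * f s
      linarith
  have hcT : c * T ^ 2 ≤ 2 - ε := by rwa [le_div_iff₀ (by positivity)] at hc
  obtain ⟨hs0, hsT⟩ := hs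
  have key := hconv.2 (left_mem_Icc.2 hT.le) (right_mem_Icc.2 hT.le)
    (show (0 : ℝ) ≤ 1 - s / T by rw [sub_nonneg, div_le_one hT]; exact hsT)
    (show (0 : ℝ) ≤ s / T by positivity) (by ring)
  have hr0 : 0 ≤ s / T := by positivity
  have hr1 : s / T ≤ 1 := by rw [div_le_one hT]; exact hsT
  have hsr : s = s / T * T := by field_simp
  generalize s / T = r at *
  simp only [smul_eq_mul, mul_zero, zero_add, ← hsr, hf0, hfT] at key
  have e : s ^ 2 = r ^ 2 * T ^ 2 := by rw [hsr]; ring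
  rw [e] at key
  have hk : f s ≤ (a + b) + (c * T ^ 2) * f s / 2 * (r * (1 - r)) := by
    nlinarith [mul_nonneg hr0 ha, mul_nonneg (sub_nonneg.2 hr1) hb]
  have h4 : r * (1 - r) ≤ 1 / 4 := by nlinarith [sq_nonneg (r - 1 / 2)]
  have h5 : (c * T ^ 2) * f s ≤ (2 - ε) * f s := mul_le_mul_of_nonneg_right hcT hM0
  have h6 : (c * T ^ 2) * f s / 2 * (r * (1 - r)) ≤ (c * T ^ 2) * f s / 2 * (1 / 4) :=
    mul_le_mul_of_nonneg_left h4 (by positivity)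
  rw [le_div_iff₀ hε]
  have h7 := mul_le_mul_of_nonneg_right (hM t ht) hε.le
  nlinarith [mul_nonneg (sub_nonneg.2 hε2) hM0]
end

section
/- Failure of the uniform bound for large c: let T > 0, c ≥ π²/T², and for k ∈ ℕ define f_k(t) = k·sin(πt/T) + 1. Then for every k ∈ ℕ, f_k is a non-negative C² function on [0,T] with f_k''(t) + c f_k(t) ≥ 0 for all t ∈ [0,T] and f_k(0) = f_k(T) = 1, while f_k(T/2) = k + 1; hence sup_k max_{t∈[0,T]} f_k(t) = ∞, i.e., there is no constant M such that every non-negative C² function f on [0,T] with f'' + c f ≥ 0 and f(0) = f(T) = 1 satisfies f ≤ M. -/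
open Set Real

theorem no_uniform_bound_for_large_c
    (T : ℝ) (hT : 0 < T) (c : ℝ) (hc : π ^ 2 / T ^ 2 ≤ c) :
    (∀ k : ℕ,
      (∀ t ∈ Set.Icc (0 : ℝ) T, 0 ≤ (k : ℝ) * Real.sin (π * t / T) + 1) ∧
      ContDiff ℝ 2 (fun t : ℝ => (k : ℝ) * Real.sin (π * t / T) + 1) ∧
      (∀ t ∈ Set.Icc (0 : ℝ) T,
        0 ≤ deriv (deriv (fun s : ℝ => (k : ℝ) * Real.sin (π * s / T) + 1)) t +
          c * ((k : ℝ) * Real.sin (π * t / T) + 1)) ∧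
      ((k : ℝ) * Real.sin (π * 0 / T) + 1 = 1) ∧
      ((k : ℝ) * Real.sin (π * T / T) + 1 = 1) ∧
      ((k : ℝ) * Real.sin (π * (T / 2) / T) + 1 = (k : ℝ) + 1)) ∧
    ¬∃ M : ℝ, ∀ f : ℝ → ℝ,
      (∀ t ∈ Set.Icc (0 : ℝ) T, 0 ≤ f t) →
      ContDiff ℝ 2 f →
      (∀ t ∈ Set.Icc (0 : ℝ) T, 0 ≤ deriv (deriv f) t + c * f t) →
      f 0 = 1 → f T = 1 →
      ∀ t ∈ Set.Icc (0 : ℝ) T, f t ≤ M := by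
  have hsin : ∀ t ∈ Set.Icc (0 : ℝ) T, 0 ≤ Real.sin (π * t / T) := by
    intro t ht
    apply Real.sin_nonneg_of_nonneg_of_le_pi
    · exact div_nonneg (mul_nonneg Real.pi_pos.le ht.1) hT.le
    · rw [div_le_iff₀ hT]
      exact mul_le_mul_of_nonneg_left ht.2 Real.pi_pos.le
  have hc0 : 0 ≤ c := le_trans (by positivity) hc
  have key : ∀ k : ℕ,
      (∀ t ∈ Set.Icc (0 : ℝ) T, 0 ≤ (k : ℝ) * Real.sin (π * t / T) + 1) ∧
      ContDiff ℝ 2 (fun t : ℝ => (k : ℝ) * Real.sin (π * t / T) + 1) ∧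
      (∀ t ∈ Set.Icc (0 : ℝ) T,
        0 ≤ deriv (deriv (fun s : ℝ => (k : ℝ) * Real.sin (π * s / T) + 1)) t +
          c * ((k : ℝ) * Real.sin (π * t / T) + 1)) ∧
      ((k : ℝ) * Real.sin (π * 0 / T) + 1 = 1) ∧
      ((k : ℝ) * Real.sin (π * T / T) + 1 = 1) ∧
      ((k : ℝ) * Real.sin (π * (T / 2) / T) + 1 = (k : ℝ) + 1) := by
    intro k
    refine ⟨?_, by fun_prop, ?_, by simp, ?_, ?_⟩
    · intro t ht
      have := hsin t ht
      positivity
    · intro t ht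
      have hin : ∀ s : ℝ, HasDerivAt (fun s : ℝ => π * s / T) (π / T) s := by
        intro s
        simpa using ((hasDerivAt_id s).const_mul π).div_const T
      have h1 : deriv (fun s : ℝ => (k : ℝ) * Real.sin (π * s / T) + 1) =
          fun s => (k : ℝ) * (Real.cos (π * s / T) * (π / T)) := by
        funext s
        exact (((hin s).sin.const_mul (k : ℝ)).add_const 1).deriv
      have h2 : deriv (fun s : ℝ => (k : ℝ) * (Real.cos (π * s / T) * (π / T))) t =
          (k : ℝ) * (-Real.sin (π * t / T) * (π / T) * (π / T)) :=
        (((hin t).cos.mul_const (π / T)).const_mul (k : ℝ)).deriv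
      rw [h1, h2]
      have h3 : 0 ≤ (k : ℝ) * Real.sin (π * t / T) := mul_nonneg k.cast_nonneg (hsin t ht)
      have h4 := mul_nonneg (sub_nonneg.2 hc) h3
      have h5 : (k : ℝ) * (-Real.sin (π * t / T) * (π / T) * (π / T)) +
          c * ((k : ℝ) * Real.sin (π * t / T) + 1) =
          (c - π ^ 2 / T ^ 2) * ((k : ℝ) * Real.sin (π * t / T)) + c := by
        rw [← div_pow]; ring
      rw [h5]
      exact add_nonneg h4 hc0
    · rw [mul_div_cancel_right₀ _ hT.ne']; simp
    · have : π * (T / 2) / T = π / 2 := by field_simp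
      rw [this]; simp
  refine ⟨key, ?_⟩
  rintro ⟨M, hM⟩
  obtain ⟨k, hk⟩ := exists_nat_gt M
  obtain ⟨a, b, d, e, f, g⟩ := key k
  have h := hM _ a b d e f (T / 2) ⟨by linarith, by linarith⟩
  simp only [g] at h
  linarith
end

section
/- Moser iteration sequence lemma: let α > 0, β = 3/2, q_n = β^n for n ∈ ℕ, and γ_n = (q_{n+1} − q_n)/(q_{n+1} − α). Let N_0 ∈ ℕ be such that for all n ≥ N_0 one has q_n > α + q_{n−1} (so 0 < γ_n < 1) and 1/(1 − γ_n) < 2. Let C ≥ 1 and let (M_n)_{n ≥ N_0} be a sequence of reals with M_n ≥ 1 for all n ≥ N_0 and M_{n+1} ≤ C q_{n+1}² M_n^{1/(1−γ_n)} for all n ≥ N_0. Then the sequence (M_n^{1/q_n})_{n ≥ N_0} is bounded. -/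
open Real

theorem moser_iteration_sequence_bounded
    (α : ℝ) (hα : 0 < α)
    (q : ℕ → ℝ) (hq : ∀ n : ℕ, q n = (3 / 2 : ℝ) ^ n)
    (γ : ℕ → ℝ) (hγ : ∀ n : ℕ, γ n = (q (n + 1) - q n) / (q (n + 1) - α))
    (N₀ : ℕ)
    (hN₀ : ∀ n : ℕ, N₀ ≤ n → q n > α + q (n - 1))
    (hN₀' : ∀ n : ℕ, N₀ ≤ n → 1 / (1 - γ n) < 2)
    (C : ℝ) (hC : 1 ≤ C)
    (M : ℕ → ℝ)
    (hM1 : ∀ n : ℕ, N₀ ≤ n → 1 ≤ M n)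
    (hrec : ∀ n : ℕ, N₀ ≤ n → M (n + 1) ≤ C * (q (n + 1)) ^ 2 * M n ^ (1 / (1 - γ n))) :
    ∃ B : ℝ, ∀ n : ℕ, N₀ ≤ n → M n ^ (1 / q n) ≤ B := by
  have qpos : ∀ n, 0 < q n := fun n => by rw [hq]; positivity
  have qsucc : ∀ n, q (n + 1) = 3 / 2 * q n := fun n => by rw [hq, hq, pow_succ]; ring
  have hgt : ∀ n, N₀ ≤ n → 0 < q n - α := fun n hn => by
    have h1 := hN₀ n hn
    have h2 := qpos (n - 1)
    linarith
  have hL : 0 ≤ Real.log (3 / 2) := Real.log_nonneg (by norm_num)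
  have hLC : 0 ≤ Real.log C := Real.log_nonneg hC
  obtain ⟨K, hK⟩ : ∃ K, K = Real.log C + 2 * Real.log (3 / 2) := ⟨_, rfl⟩
  have hK0 : 0 ≤ K := by rw [hK]; positivity
  have hstep : ∀ n, N₀ ≤ n → Real.log (M (n + 1)) / (q (n + 1) - α) + K * ((3 * ((n + 1 : ℕ) : ℝ) + 9) / q (n + 1))
      ≤ Real.log (M n) / (q n - α) + K * ((3 * (n : ℝ) + 9) / q n) := by
    intro n hn
    have d0 := hgt n hn
    have d1 := hgt (n + 1) (by omega)
    have hqn : q n < q (n + 1) - α := by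
      have h := hN₀ (n + 1) (by omega)
      simp only [Nat.add_sub_cancel] at h
      linarith
    have hM0 : 0 < M n := by linarith [hM1 n hn]
    have hM0' : 0 < M (n + 1) := by linarith [hM1 (n + 1) (by omega)]
    have hexp : 1 / (1 - γ n) = (q (n + 1) - α) / (q n - α) := by
      have : 1 - γ n = (q n - α) / (q (n + 1) - α) := by
        rw [hγ]; field_simp; ring
      rw [this, one_div_div]
    have hlog : Real.log (M (n + 1)) ≤ Real.log C + 2 * (((n : ℝ) + 1) * Real.log (3 / 2))
        + (q (n + 1) - α) / (q n - α) * Real.log (M n) := by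
      have h := Real.log_le_log hM0' (hrec n hn)
      have hq1 := qpos (n + 1)
      have hC0 : 0 < C := by linarith
      rw [Real.log_mul (by positivity) (by positivity), Real.log_mul (by positivity) (by positivity),
        Real.log_rpow hM0, Real.log_pow, hexp, hq (n + 1), Real.log_pow, ← hq (n + 1)] at h
      push_cast at h
      exact h
    have hlog2 : Real.log (M (n + 1)) ≤ K * ((n : ℝ) + 1)
        + (q (n + 1) - α) / (q n - α) * Real.log (M n) := by
      have : 0 ≤ Real.log C * (n : ℝ) := by positivity
      rw [hK]; linarith
    have h3 : Real.log (M (n + 1)) / (q (n + 1) - α) ≤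
        K * ((n : ℝ) + 1) / (q (n + 1) - α) + Real.log (M n) / (q n - α) := by
      rw [div_le_iff₀ d1]
      refine hlog2.trans (le_of_eq ?_)
      field_simp
    have h4 : K * ((n : ℝ) + 1) / (q (n + 1) - α) ≤ K * ((n : ℝ) + 1) / q n :=
      div_le_div_of_nonneg_left (by positivity) (qpos n) hqn.le
    have h5 : K * ((n : ℝ) + 1) / q n + K * ((3 * ((n + 1 : ℕ) : ℝ) + 9) / q (n + 1))
        = K * ((3 * (n : ℝ) + 9) / q n) := by
      have := qpos n
      rw [qsucc]
      push_cast
      field_simp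
      ring
    linarith
  obtain ⟨B, hB⟩ : ∃ B, B = Real.log (M N₀) / (q N₀ - α) + K * ((3 * (N₀ : ℝ) + 9) / q N₀) := ⟨_, rfl⟩
  have hbd : ∀ n, N₀ ≤ n → Real.log (M n) / (q n - α) + K * ((3 * (n : ℝ) + 9) / q n) ≤ B := by
    intro n hn
    induction n, hn using Nat.le_induction with
    | base => exact hB.ge
    | succ n hn ih => exact (hstep n hn).trans ih
  refine ⟨Real.exp B, fun n hn => ?_⟩
  have hM0 : 0 < M n := by linarith [hM1 n hn]
  rw [Real.rpow_def_of_pos hM0]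
  apply Real.exp_le_exp.mpr
  have h1 := hbd n hn
  have hqn := qpos n
  have h2 : 0 ≤ K * ((3 * (n : ℝ) + 9) / q n) := by positivity
  have h3 : Real.log (M n) / q n ≤ Real.log (M n) / (q n - α) :=
    div_le_div_of_nonneg_left (Real.log_nonneg (hM1 n hn)) (hgt n hn) (by linarith)
  rw [mul_one_div]
  linarith
end

section
/- Product bound via a q-Pochhammer-type infinite product: let α > 0, β = 3/2, q_n = β^n, and γ_n = (q_{n+1} − q_n)/(q_{n+1} − α). Let N_0 ∈ ℕ be such that q_j > α + q_{j−1} for all j ≥ N_0. Then the infinite product ρ := ∏_{j=0}^{∞} (1 + (α/β^{N_0}) β^{−j}) converges to a finite positive real number, for all n ≥ k ≥ N_0 one has ∏_{j=k}^{n} 1/(β(1 − γ_j)) < ρ, and consequently Φ^n_k := ∏_{j=k}^{n} 1/(1 − γ_j) < ρ · β^{n−k+1}. -/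
open Real

theorem qpochhammer_product_bound
    (α : ℝ) (hα : 0 < α)
    (q : ℕ → ℝ) (hq : ∀ n : ℕ, q n = (3 / 2 : ℝ) ^ n)
    (γ : ℕ → ℝ) (hγ : ∀ n : ℕ, γ n = (q (n + 1) - q n) / (q (n + 1) - α))
    (N₀ : ℕ)
    (hN₀ : ∀ j : ℕ, N₀ ≤ j → q j > α + q (j - 1)) :
    Multipliable (fun j : ℕ => 1 + α / (3 / 2 : ℝ) ^ N₀ * ((3 / 2 : ℝ)⁻¹) ^ j) ∧
    0 < (∏' j : ℕ, (1 + α / (3 / 2 : ℝ) ^ N₀ * ((3 / 2 : ℝ)⁻¹) ^ j)) ∧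
    (∀ k n : ℕ, N₀ ≤ k → k ≤ n →
      ∏ j ∈ Finset.Icc k n, ((3 / 2 : ℝ) * (1 - γ j))⁻¹ <
        ∏' j : ℕ, (1 + α / (3 / 2 : ℝ) ^ N₀ * ((3 / 2 : ℝ)⁻¹) ^ j)) ∧
    (∀ k n : ℕ, N₀ ≤ k → k ≤ n →
      ∏ j ∈ Finset.Icc k n, (1 - γ j)⁻¹ <
        (∏' j : ℕ, (1 + α / (3 / 2 : ℝ) ^ N₀ * ((3 / 2 : ℝ)⁻¹) ^ j)) *
          (3 / 2 : ℝ) ^ (n - k + 1)) := by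
  have hN1 : 1 ≤ N₀ := by
    by_contra h
    have := hN₀ 0 (by omega)
    simp at this
    linarith
  set a : ℕ → ℝ := fun j : ℕ => 1 + α / (3 / 2 : ℝ) ^ N₀ * ((3 / 2 : ℝ)⁻¹) ^ j with ha
  have hmul : Multipliable a := by
    apply Real.multipliable_one_add_of_summable
    exact (summable_geometric_of_lt_one (by norm_num) (by norm_num)).mul_left _
  have ha1 : ∀ j, 1 ≤ a j := by
    intro j
    have : 0 ≤ α / (3 / 2 : ℝ) ^ N₀ * ((3 / 2 : ℝ)⁻¹) ^ j := by positivity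
    simp only [ha]
    linarith
  have hle : ∀ s : Finset ℕ, ∏ j ∈ s, a j ≤ ∏' j, a j := by
    intro s
    have h : Filter.Tendsto (fun t : Finset ℕ => ∏ j ∈ t, a j) Filter.atTop (nhds (∏' j, a j)) := by
      simpa [HasProd] using hmul.hasProd
    refine ge_of_tendsto h ?_
    filter_upwards [Filter.eventually_ge_atTop s] with t ht
    rw [← Finset.prod_sdiff ht]
    refine le_mul_of_one_le_left (Finset.prod_nonneg fun i _ => zero_le_one.trans (ha1 i)) ?_
    calc (1 : ℝ) = ∏ i ∈ t \ s, (1 : ℝ) := by simp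
      _ ≤ _ := Finset.prod_le_prod (fun _ _ => zero_le_one) (fun i _ => ha1 i)
  have hfac : ∀ j, N₀ ≤ j → 0 < ((3 / 2 : ℝ) * (1 - γ j))⁻¹ ∧
      ((3 / 2 : ℝ) * (1 - γ j))⁻¹ < a (j - N₀) := by
    intro j hj
    have haj : a (j - N₀) = 1 + α / q j := by
      obtain ⟨d, rfl⟩ := Nat.exists_eq_add_of_le hj
      simp only [ha, hq, Nat.add_sub_cancel_left, pow_add, inv_pow]
      field_simp
    have h1 := hN₀ j hj
    have h2 : q j = 3 / 2 * q (j - 1) := by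
      obtain ⟨d, rfl⟩ := Nat.exists_eq_add_of_le (hN1.trans hj)
      simp only [hq, Nat.add_sub_cancel_left, pow_add]
      ring
    have h3 : q (j + 1) = 3 / 2 * q j := by
      simp only [hq, pow_succ]
      ring
    have h4 : 0 < q (j - 1) := by
      rw [hq]
      positivity
    have hp : 0 < q j := by linarith
    have hd : 0 < q j - α := by linarith
    have hd' : 0 < 3 / 2 * q j - α := by linarith
    have e : ((3 / 2 : ℝ) * (1 - γ j))⁻¹ = (3 / 2 * q j - α) / (3 / 2 * (q j - α)) := by
      have : 1 - γ j = (q j - α) / (3 / 2 * q j - α) := by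
        rw [hγ, h3, eq_div_iff hd'.ne', sub_mul, div_mul_cancel₀ _ hd'.ne']
        ring
      rw [this, ← mul_div_assoc, inv_div]
    rw [e, haj]
    refine ⟨by positivity, ?_⟩
    have : 1 + α / q j = (q j + α) / q j := by field_simp
    rw [this, div_lt_div_iff₀ (by positivity) hp]
    have h5 : α < q j / 3 := by linarith
    nlinarith [mul_pos hα hp, mul_pos hα (sub_pos.2 h5)]
  have hmain : ∀ k n : ℕ, N₀ ≤ k → k ≤ n →
      ∏ j ∈ Finset.Icc k n, ((3 / 2 : ℝ) * (1 - γ j))⁻¹ < ∏' j : ℕ, a j := by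
    intro k n hk hkn
    have hge : ∀ j ∈ Finset.Icc k n, N₀ ≤ j := fun j hj => hk.trans (Finset.mem_Icc.1 hj).1
    calc _ < ∏ j ∈ Finset.Icc k n, a (j - N₀) :=
          Finset.prod_lt_prod_of_nonempty (fun j hj => (hfac j (hge j hj)).1)
            (fun j hj => (hfac j (hge j hj)).2) ⟨k, Finset.mem_Icc.2 ⟨le_rfl, hkn⟩⟩
      _ = ∏ i ∈ (Finset.Icc k n).image (fun j => j - N₀), a i := by
          rw [Finset.prod_image]
          intro x hx y hy hxy
          have := hge x hx
          have := hge y hy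
          simp only at hxy
          omega
      _ ≤ _ := hle _
  refine ⟨hmul, ?_, hmain, ?_⟩
  · have := hle ∅
    simp only [Finset.prod_empty] at this
    linarith
  · intro k n hk hkn
    have h := hmain k n hk hkn
    have e : ∏ j ∈ Finset.Icc k n, (1 - γ j)⁻¹ =
        (∏ j ∈ Finset.Icc k n, ((3 / 2 : ℝ) * (1 - γ j))⁻¹) * (3 / 2 : ℝ) ^ (n - k + 1) := by
      have hc : n - k + 1 = (Finset.Icc k n).card := by
        rw [Nat.card_Icc]
        omega
      rw [hc, ← Finset.prod_const, ← Finset.prod_mul_distrib]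
      refine Finset.prod_congr rfl fun j _ => ?_
      rw [mul_inv]
      ring
    rw [e]
    exact mul_lt_mul_of_pos_right h (by positivity)
end

section
/- Bound on the iterated sums of products: let α > 0, β = 3/2, q_n = β^n, γ_n = (q_{n+1} − q_n)/(q_{n+1} − α), and let N_0 ∈ ℕ be such that q_j > α + q_{j−1} for all j ≥ N_0. Set Φ^n_k = ∏_{j=k}^{n} 1/(1 − γ_j) and Ψ_n = Σ_{k=N_0+1}^{n} Φ^n_k, and let ρ = ∏_{j=0}^{∞} (1 + (α/β^{N_0}) β^{−j}). Then for all n > N_0, Ψ_n < ρ · β(β^{n−N_0} − 1)/(β − 1). -/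
open Real

theorem psi_sum_of_products_bound
    (α : ℝ) (hα : 0 < α)
    (q : ℕ → ℝ) (hq : ∀ n : ℕ, q n = (3 / 2 : ℝ) ^ n)
    (γ : ℕ → ℝ) (hγ : ∀ n : ℕ, γ n = (q (n + 1) - q n) / (q (n + 1) - α))
    (N₀ : ℕ)
    (hN₀ : ∀ j : ℕ, N₀ ≤ j → q j > α + q (j - 1))
    (Φ : ℕ → ℕ → ℝ)
    (hΦ : ∀ k n : ℕ, Φ k n = ∏ j ∈ Finset.Icc k n, (1 - γ j)⁻¹)
    (Ψ : ℕ → ℝ)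
    (hΨ : ∀ n : ℕ, Ψ n = ∑ k ∈ Finset.Icc (N₀ + 1) n, Φ k n)
    (ρ : ℝ)
    (hρ : ρ = ∏' j : ℕ, (1 + α / (3 / 2 : ℝ) ^ N₀ * ((3 / 2 : ℝ)⁻¹) ^ j)) :
    ∀ n : ℕ, N₀ < n →
      Ψ n < ρ * ((3 / 2 : ℝ) * ((3 / 2 : ℝ) ^ (n - N₀) - 1) / ((3 / 2 : ℝ) - 1)) := by
  intro n hn
  have hpos : ∀ k, 0 < q k := fun k => by rw [hq]; positivity
  have hsucc : ∀ k, q (k + 1) = 3 / 2 * q k := fun k => by rw [hq, hq, pow_succ]; ring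
  have hbig : ∀ k, N₀ ≤ k → 3 * α < q k := by
    intro k hk
    rcases k with _ | k
    · have := hN₀ 0 hk
      simp at this
      linarith
    · have := hN₀ (k + 1) hk
      simp only [Nat.add_sub_cancel] at this
      have := hsucc k
      linarith
  have hinv : ∀ k, N₀ ≤ k → (1 - γ k)⁻¹ = (q (k + 1) - α) / (q k - α) := by
    intro k hk
    have h1 := hbig k hk
    have h2 := hsucc k
    have h3 : q (k + 1) - α ≠ 0 := by
      have := hpos k
      linarith
    have : 1 - γ k = (q k - α) / (q (k + 1) - α) := by
      rw [hγ, eq_div_iff h3, sub_mul, div_mul_cancel₀ _ h3]; ring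
    rw [this, inv_div]
  have hprod : ∀ k, N₀ ≤ k → ∀ n, k ≤ n → Φ k n = (q (n + 1) - α) / (q k - α) := by
    intro k hk n hkn
    rw [hΦ]
    induction n, hkn using Nat.le_induction with
    | base => simp [hinv k hk]
    | succ m hm ih =>
      rw [Finset.prod_Icc_succ_top (by omega), ih, hinv (m + 1) (by omega)]
      have h1 := hbig (m + 1) (by omega)
      have h2 : q (m + 1) - α ≠ 0 := by linarith
      rw [mul_comm, div_mul_div_cancel₀ h2]
  have hρ1 : 1 + α / q N₀ ≤ ρ := by
    have hs : Summable (fun j : ℕ => α / (3 / 2 : ℝ) ^ N₀ * ((3 / 2 : ℝ)⁻¹) ^ j) :=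
      (summable_geometric_of_lt_one (by norm_num) (by norm_num)).mul_left _
    have hm : Multipliable (fun j : ℕ => 1 + α / (3 / 2 : ℝ) ^ N₀ * ((3 / 2 : ℝ)⁻¹) ^ j) :=
      Real.multipliable_one_add_of_summable hs
    have ht := hm.hasProd.tendsto_prod_nat
    rw [← hρ] at ht
    refine ge_of_tendsto ht (Filter.eventually_atTop.2 ⟨1, fun m hm => ?_⟩)
    obtain ⟨m, rfl⟩ := Nat.exists_eq_add_of_le' hm
    rw [Finset.prod_range_succ', hq]
    have h1 : (1 : ℝ) ≤ ∏ j ∈ Finset.range m,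
        (1 + α / (3 / 2 : ℝ) ^ N₀ * ((3 / 2 : ℝ)⁻¹) ^ (j + 1)) := by
      refine Finset.prod_induction _ (fun x : ℝ => 1 ≤ x)
        (fun a b ha hb => one_le_mul_of_one_le_of_one_le ha hb) le_rfl ?_
      intro j _
      have : 0 < α / (3 / 2 : ℝ) ^ N₀ * ((3 / 2 : ℝ)⁻¹) ^ (j + 1) := by positivity
      linarith
    rw [pow_zero, mul_one]
    exact le_mul_of_one_le_left (by positivity) h1
  have hmono : ∀ k, N₀ < k → 3 / 2 * q N₀ ≤ q k := by
    intro k hk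
    rw [← hsucc, hq, hq]
    exact pow_le_pow_right₀ (by norm_num) hk
  have hterm : ∀ k ∈ Finset.Icc (N₀ + 1) n, Φ k n < ρ * (q (n + 1) * (q k)⁻¹) := by
    intro k hk
    rw [Finset.mem_Icc] at hk
    rw [hprod k (by omega) n hk.2]
    have h1 := hbig k (by omega)
    have h0 := hbig N₀ le_rfl
    have h2 := hmono k (by omega)
    have hk0 := hpos k
    have hN := hpos N₀
    have hn1 := hpos (n + 1)
    have hka : 0 < q k - α := by linarith
    have key : q k ≤ (1 + α / q N₀) * (q k - α) := by
      have : (1 + α / q N₀) * (q k - α) = q k + α * (q k - α - q N₀) / q N₀ := by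
        field_simp; ring
      rw [this]
      have : 0 ≤ α * (q k - α - q N₀) / q N₀ :=
        div_nonneg (mul_nonneg hα.le (by linarith)) hN.le
      linarith
    have key2 : q k ≤ ρ * (q k - α) :=
      key.trans (mul_le_mul_of_nonneg_right hρ1 hka.le)
    rw [div_lt_iff₀ hka]
    calc q (n + 1) - α < q (n + 1) := by linarith
      _ = q (n + 1) * (q k)⁻¹ * q k := by field_simp
      _ ≤ q (n + 1) * (q k)⁻¹ * (ρ * (q k - α)) :=
        mul_le_mul_of_nonneg_left key2 (by positivity)
      _ = _ := by ring
  have hsum : ∀ m, ∑ k ∈ Finset.Icc (N₀ + 1) (N₀ + m), (q k)⁻¹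
      = 2 * ((q N₀)⁻¹ - (q (N₀ + m))⁻¹) := by
    intro m
    induction m with
    | zero => simp
    | succ m ih =>
      rw [← add_assoc, Finset.sum_Icc_succ_top (by omega), ih, hsucc (N₀ + m)]
      have := hpos (N₀ + m)
      have := hpos N₀
      field_simp
      ring
  rw [hΨ]
  refine (Finset.sum_lt_sum_of_nonempty (Finset.nonempty_Icc.2 hn) hterm).trans_le (le_of_eq ?_)
  rw [← Finset.mul_sum, ← Finset.mul_sum]
  obtain ⟨m, rfl⟩ := Nat.exists_eq_add_of_le hn.le
  rw [hsum, hsucc]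
  congr 1
  rw [Nat.add_sub_cancel_left, hq, hq, pow_add _ N₀]
  field_simp
  ring
end
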